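/- Sublevel set estimate: Let $I=[\delta,2\delta]$ with $0 < \delta \leq 1$ small, and $K \subseteq \mathbb{R}^2 \times I$ compact with $K \subseteq [0,1]^2 \times I$. Let $\alpha, \beta : \mathbb{R}^2 \to \mathbb{R}$ be measurable functions such that $|\alpha| \sim 1$ and $|\beta| \lesssim 1$ on $\mathbb{R}^2$. Then there exists a constant $C$ (independent of $\delta$, $\epsilon$, $\alpha$, $\beta$) such that for all $\epsilon \in (0,1]$, the set $\{(x,y,t) \in K : |\alpha(x+\cos t, y)\sin t + \beta(x, y+\sin t)\cos t| \leq \delta\epsilon\}$ has Lebesgue measure at most $C\,\delta\,\epsilon^{1/35}$. -/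

import Mathlib

open MeasureTheory Set

namespace SLE

noncomputable def kap (X Y : ℝ) : ℝ := X^2 + Y^2 - 1
noncomputable def RR (X Y t : ℝ) : ℝ := kap X Y + 2 + 2 * (X * Real.cos t + Y * Real.sin t)
noncomputable def uu (X Y t : ℝ) : ℝ := Real.cos t ^ 2 + X * Real.cos t + kap X Y / 4
noncomputable def vv (X Y t : ℝ) : ℝ := Real.sin t ^ 2 + Y * Real.sin t + kap X Y / 4
noncomputable def ff (X Y t : ℝ) : ℝ := Real.cos t * (Y * Real.sin t * RR X Y t + kap X Y * uu X Y t)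
noncomputable def gg (X Y t : ℝ) : ℝ := Real.sin t * (X * Real.cos t * RR X Y t + kap X Y * vv X Y t)
noncomputable def MM (X Y t τ : ℝ) : ℝ :=
  Y * Real.sin t * Real.sin τ * (Real.cos t * vv X Y τ * RR X Y t - Real.cos τ * vv X Y t * RR X Y τ)
  + X * Real.cos t * Real.cos τ * (Real.sin τ * uu X Y t * RR X Y τ - Real.sin t * uu X Y τ * RR X Y t)
  + kap X Y * (Real.cos t * Real.sin τ * uu X Y t * vv X Y τ - Real.cos τ * Real.sin t * uu X Y τ * vv X Y t)
noncomputable def du (X t : ℝ) : ℝ := - 2 * Real.cos t * Real.sin t - X * Real.sin t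
noncomputable def dv (Y t : ℝ) : ℝ := 2 * Real.sin t * Real.cos t + Y * Real.cos t
noncomputable def dR (X Y t : ℝ) : ℝ := 2 * (- X * Real.sin t + Y * Real.cos t)
noncomputable def dM (X Y t τ : ℝ) : ℝ :=
  Y * Real.sin t * (Real.cos τ * (Real.cos t * vv X Y τ * RR X Y t - Real.cos τ * vv X Y t * RR X Y τ)
    + Real.sin τ * (Real.cos t * dv Y τ * RR X Y t + Real.sin τ * vv X Y t * RR X Y τ
        - Real.cos τ * vv X Y t * dR X Y τ))
  + X * Real.cos t * (- Real.sin τ * (Real.sin τ * uu X Y t * RR X Y τ - Real.sin t * uu X Y τ * RR X Y t)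
    + Real.cos τ * (Real.cos τ * uu X Y t * RR X Y τ + Real.sin τ * uu X Y t * dR X Y τ
        - Real.sin t * du X τ * RR X Y t))
  + kap X Y * (Real.cos t * Real.cos τ * uu X Y t * vv X Y τ + Real.cos t * Real.sin τ * uu X Y t * dv Y τ
     + Real.sin τ * Real.sin t * uu X Y τ * vv X Y t - Real.cos τ * Real.sin t * du X τ * vv X Y t)

lemma fg_eq (X Y t τ : ℝ) :
    ff X Y t * gg X Y τ - ff X Y τ * gg X Y t = kap X Y * MM X Y t τ := by
  unfold ff gg MM; ring

lemma MM_self (X Y t : ℝ) : MM X Y t t = 0 := by unfold MM; ring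

lemma MM_deriv (X Y t τ : ℝ) : HasDerivAt (fun τ => MM X Y t τ) (dM X Y t τ) τ := by
  have hs := Real.hasDerivAt_sin τ
  have hc := Real.hasDerivAt_cos τ
  have hu : HasDerivAt (fun τ => uu X Y τ) (du X τ) τ := by
    unfold uu du
    refine (((hc.pow 2).add (hc.const_mul X)).add_const (kap X Y / 4)).congr_deriv ?_
    push_cast; ring
  have hv : HasDerivAt (fun τ => vv X Y τ) (dv Y τ) τ := by
    unfold vv dv
    refine (((hs.pow 2).add (hs.const_mul Y)).add_const (kap X Y / 4)).congr_deriv ?_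
    push_cast; ring
  have hR : HasDerivAt (fun τ => RR X Y τ) (dR X Y τ) τ := by
    unfold RR dR
    refine ((((hc.const_mul X).add (hs.const_mul Y)).const_mul 2).const_add (kap X Y + 2)).congr_deriv ?_
    ring
  unfold MM
  have h1 := (hs.const_mul (Y * Real.sin t)).mul
    (((hv.const_mul (Real.cos t)).mul_const (RR X Y t)).sub
      ((hc.mul_const (vv X Y t)).mul hR))
  have h2 := (hc.const_mul (X * Real.cos t)).mul
    (((hs.mul_const (uu X Y t)).mul hR).sub
      ((hu.const_mul (Real.sin t)).mul_const (RR X Y t)))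
  have h3 := ((((hs.const_mul (Real.cos t)).mul_const (uu X Y t)).mul hv).sub
    (((hc.mul_const (Real.sin t)).mul hu).mul_const (vv X Y t))).const_mul (kap X Y)
  refine ((h1.add h2).add h3).congr_deriv ?_
  simp only [Pi.mul_apply, Pi.sub_apply]
  unfold dM; ring

lemma dM_base (t : ℝ) : 5 ≤ dM (Real.cos t) (Real.sin t) t t := by
  have h := Real.sin_sq_add_cos_sq t
  have hk : kap (Real.cos t) (Real.sin t) = 0 := by unfold kap; linarith
  have hR : RR (Real.cos t) (Real.sin t) t = 4 := by unfold RR; rw [hk]; linarith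
  have hu : uu (Real.cos t) (Real.sin t) t = 2 * Real.cos t ^ 2 := by unfold uu; rw [hk]; ring
  have hv : vv (Real.cos t) (Real.sin t) t = 2 * Real.sin t ^ 2 := by unfold vv; rw [hk]; ring
  have hd : dR (Real.cos t) (Real.sin t) t = 0 := by unfold dR; ring
  unfold dM
  rw [hk, hR, hu, hv, hd]
  unfold du dv
  set s := Real.sin t
  set c := Real.cos t
  have hc : c^2 = 1 - s^2 := by linarith
  have e : ∀ x : ℝ, x = 8 - 12 * (s^2 * c^2) → 5 ≤ x := by
    intro x hx
    nlinarith [sq_nonneg (s^2 - c^2)]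
  apply e
  have h4 : c^4 = (1-s^2)^2 := by rw [← hc]; ring
  have h6 : c^6 = (1-s^2)^3 := by rw [← hc]; ring
  ring_nf
  rw [h4, h6, hc]
  ring

lemma exists_h : ∃ h : ℝ, 0 < h ∧ ∀ t0 ∈ Icc (0:ℝ) 2, ∀ X Y t τ : ℝ,
    |X - Real.cos t0| < h → |Y - Real.sin t0| < h → |t - t0| < h → |τ - t0| < h →
    1 ≤ dM X Y t τ := by
  let γ : ℝ → ℝ × ℝ × ℝ × ℝ := fun t => (Real.cos t, Real.sin t, t, t)
  let G : ℝ × ℝ × ℝ × ℝ → ℝ := fun q => dM q.1 q.2.1 q.2.2.1 q.2.2.2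
  have hG : Continuous G := by
    simp only [G, dM, vv, uu, RR, kap, dR, du, dv]
    fun_prop
  have hK : IsCompact (γ '' Icc (0:ℝ) 2) := isCompact_Icc.image (by fun_prop)
  have hU : IsOpen {q | 1 < G q} := isOpen_lt continuous_const hG
  have hsub : γ '' Icc (0:ℝ) 2 ⊆ {q | 1 < G q} := by
    rintro _ ⟨t, -, rfl⟩
    have := dM_base t
    simp only [mem_ofPred_eq, G, γ]; linarith
  obtain ⟨h, hh, hs⟩ := hK.exists_thickening_subset_open hU hsub
  refine ⟨h, hh, fun t0 ht0 X Y t τ h1 h2 h3 h4 => ?_⟩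
  have : (X, Y, t, τ) ∈ Metric.thickening h (γ '' Icc (0:ℝ) 2) := by
    rw [Metric.mem_thickening_iff]
    refine ⟨γ t0, mem_image_of_mem _ ht0, ?_⟩
    simp only [γ, Prod.dist_eq, Real.dist_eq, max_lt_iff]
    exact ⟨h1, h2, h3, h4⟩
  exact (hs this).le

lemma MM_lower {a b X Y : ℝ} (H : ∀ t ∈ Icc a b, ∀ τ ∈ Icc a b, 1 ≤ dM X Y t τ)
    {t τ : ℝ} (ht : t ∈ Icc a b) (hτ : τ ∈ Icc a b) : |t - τ| ≤ |MM X Y t τ| := by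
  have key : ∀ t ∈ Icc a b, ∀ τ ∈ Icc a b, t ≤ τ → τ - t ≤ MM X Y t τ := by
    intro t ht τ hτ hle
    have := (convex_Icc a b).mul_sub_le_image_sub_of_le_deriv (f := fun τ => MM X Y t τ) (C := 1)
      (fun x _ => (MM_deriv X Y t x).continuousAt.continuousWithinAt)
      (fun x _ => (MM_deriv X Y t x).differentiableAt.differentiableWithinAt)
      (fun x hx => by rw [(MM_deriv X Y t x).deriv]; exact H t ht x (interior_subset hx))
      t ht τ hτ hle
    simp only [MM_self] at this
    linarith
  rcases le_total t τ with h | h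
  · have := key t ht τ hτ h
    rw [abs_sub_comm, abs_of_nonneg (by linarith)]
    exact this.trans (le_abs_self _)
  · have := key τ hτ t ht h
    have e : MM X Y t τ = - MM X Y τ t := by unfold MM; ring
    rw [e, abs_neg, abs_of_nonneg (by linarith)]
    exact this.trans (le_abs_self _)

/-- kappa in terms of angles -/
lemma kap_eq (t1 t2 t3 : ℝ) :
    kap (Real.cos t1 - Real.cos t2 + Real.cos t3) (Real.sin t1 - Real.sin t2 + Real.sin t3)
     = 8 * Real.cos ((t1 - t3)/2) * Real.sin ((t1-t2)/2) * Real.sin ((t3-t2)/2) := by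
  have e1 : kap (Real.cos t1 - Real.cos t2 + Real.cos t3) (Real.sin t1 - Real.sin t2 + Real.sin t3)
     = 2 * (1 - Real.cos (t1 - t2) - Real.cos (t3-t2) + Real.cos (t1 - t3)) := by
    simp only [kap, Real.cos_sub]
    linear_combination Real.sin_sq_add_cos_sq t1 + Real.sin_sq_add_cos_sq t2 + Real.sin_sq_add_cos_sq t3
  rw [e1]
  have a1 : t1 - t2 = 2 * ((t1-t2)/2) := by ring
  have a2 : t3 - t2 = 2 * ((t3-t2)/2) := by ring
  have a3 : t1 - t3 = 2 * ((t1-t2)/2 - (t3-t2)/2) := by ring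
  have a4 : (t1 - t3)/2 = ((t1-t2)/2 - (t3-t2)/2) := by ring
  rw [a4]
  conv_lhs => rw [a1, a2, a3]
  rw [Real.cos_two_mul, Real.cos_two_mul, Real.cos_two_mul]
  simp only [Real.cos_sub]
  set x := (t1-t2)/2
  set y := (t3-t2)/2
  have hx := Real.sin_sq_add_cos_sq x
  have hy := Real.sin_sq_add_cos_sq y
  have hx' : Real.cos x ^2 = 1 - Real.sin x ^2 := by linarith
  have hy' : Real.cos y ^2 = 1 - Real.sin y ^2 := by linarith
  ring_nf
  rw [hx', hy']
  ring

lemma RR_eq (t1 t2 t3 : ℝ) :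
    RR (Real.cos t1 - Real.cos t2 + Real.cos t3) (Real.sin t1 - Real.sin t2 + Real.sin t3) t2
    = 2 + 2 * (Real.cos t1 * Real.cos t3 + Real.sin t1 * Real.sin t3) := by
  unfold RR kap
  linear_combination Real.sin_sq_add_cos_sq t1 - Real.sin_sq_add_cos_sq t2 + Real.sin_sq_add_cos_sq t3

lemma aux1 (X Y t : ℝ) : Y * Real.sin t * RR X Y t + kap X Y * uu X Y t
    = RR X Y t ^ 2 / 4 - (X + Real.cos t)^2 := by
  have h : Real.sin t ^ 2 = 1 - Real.cos t ^ 2 := by linarith [Real.sin_sq_add_cos_sq t]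
  unfold RR uu kap
  ring_nf
  rw [h]
  ring

lemma aux2 (X Y t : ℝ) : X * Real.cos t * RR X Y t + kap X Y * vv X Y t
    = RR X Y t ^ 2 / 4 - (Y + Real.sin t)^2 := by
  have h : Real.cos t ^ 2 = 1 - Real.sin t ^ 2 := by linarith [Real.sin_sq_add_cos_sq t]
  unfold RR vv kap
  ring_nf
  rw [h]
  ring

lemma ff_eq (t1 t2 t3 : ℝ) :
    ff (Real.cos t1 - Real.cos t2 + Real.cos t3) (Real.sin t1 - Real.sin t2 + Real.sin t3) t2
    = RR (Real.cos t1 - Real.cos t2 + Real.cos t3) (Real.sin t1 - Real.sin t2 + Real.sin t3) t2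
      * (Real.sin t1 * Real.cos t2 * Real.sin t3) := by
  unfold ff
  rw [aux1, RR_eq]
  have h1 : Real.cos t1 ^ 2 = 1 - Real.sin t1 ^ 2 := by linarith [Real.sin_sq_add_cos_sq t1]
  have h3 : Real.cos t3 ^ 2 = 1 - Real.sin t3 ^ 2 := by linarith [Real.sin_sq_add_cos_sq t3]
  ring_nf
  rw [h1, h3]
  ring

lemma gg_eq (t1 t2 t3 : ℝ) :
    gg (Real.cos t1 - Real.cos t2 + Real.cos t3) (Real.sin t1 - Real.sin t2 + Real.sin t3) t2
    = RR (Real.cos t1 - Real.cos t2 + Real.cos t3) (Real.sin t1 - Real.sin t2 + Real.sin t3) t2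
      * (Real.cos t1 * Real.sin t2 * Real.cos t3) := by
  unfold gg
  rw [aux2, RR_eq]
  have h1 : Real.cos t1 ^ 2 = 1 - Real.sin t1 ^ 2 := by linarith [Real.sin_sq_add_cos_sq t1]
  have h3 : Real.cos t3 ^ 2 = 1 - Real.sin t3 ^ 2 := by linarith [Real.sin_sq_add_cos_sq t3]
  ring_nf
  rw [h1, h3]
  ring

lemma gg_bound {X Y t δ : ℝ} (hX : |X| ≤ 3) (hY : |Y| ≤ 3) (ht : |t| ≤ 2 * δ) :
    |gg X Y t| ≤ 600 * δ := by
  have hs : |Real.sin t| ≤ 2 * δ := Real.abs_sin_le_abs.trans ht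
  have hs1 := Real.abs_sin_le_one t
  have hc1 := Real.abs_cos_le_one t
  have hX2 : X^2 ≤ 9 := by nlinarith [sq_abs X, abs_nonneg X]
  have hY2 : Y^2 ≤ 9 := by nlinarith [sq_abs Y, abs_nonneg Y]
  have hk : |kap X Y| ≤ 17 := by
    unfold kap; rw [abs_le]; constructor <;> nlinarith [sq_nonneg X, sq_nonneg Y]
  have hXc : |X * Real.cos t| ≤ 3 := by
    rw [abs_mul]; nlinarith [abs_nonneg X, abs_nonneg (Real.cos t)]
  have hYs : |Y * Real.sin t| ≤ 3 := by
    rw [abs_mul]; nlinarith [abs_nonneg Y, abs_nonneg (Real.sin t)]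
  have hR : |RR X Y t| ≤ 31 := by
    unfold RR
    rw [abs_le] at *
    constructor <;> linarith
  have hv : |vv X Y t| ≤ 9 := by
    unfold vv
    have : Real.sin t ^ 2 ≤ 1 := Real.sin_sq_le_one t
    have := sq_nonneg (Real.sin t)
    rw [abs_le] at *
    constructor <;> linarith
  unfold gg
  rw [abs_mul]
  have : |X * Real.cos t * RR X Y t + kap X Y * vv X Y t| ≤ 300 := by
    refine (abs_add_le _ _).trans ?_
    rw [abs_mul, abs_mul (kap X Y)]
    have h1 := mul_le_mul hXc hR (abs_nonneg _) (by norm_num)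
    have h2 := mul_le_mul hk hv (abs_nonneg _) (by norm_num)
    linarith
  calc _ ≤ (2 * δ) * 300 := mul_le_mul hs this (abs_nonneg _) ((abs_nonneg _).trans hs)
    _ = _ := by ring

lemma angle_inj {a b a' b' : ℝ} (ha : a ∈ Icc (0:ℝ) 2) (hb : b ∈ Icc (0:ℝ) 2)
    (ha' : a' ∈ Icc (0:ℝ) 2) (hb' : b' ∈ Icc (0:ℝ) 2) (hab : a ≤ b) (hab' : a' ≤ b')
    (hc : Real.cos a + Real.cos b = Real.cos a' + Real.cos b')
    (hs : Real.sin a + Real.sin b = Real.sin a' + Real.sin b') : a = a' ∧ b = b' := by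
  obtain ⟨ha0, ha1⟩ := ha
  obtain ⟨hb0, hb1⟩ := hb
  obtain ⟨ha0', ha1'⟩ := ha'
  obtain ⟨hb0', hb1'⟩ := hb'
  have hpi := Real.pi_gt_three
  have hd : Real.cos (b - a) = Real.cos (b' - a') := by
    rw [Real.cos_sub, Real.cos_sub]
    have h1 := congrArg (fun x => x^2) hc
    have h2 := congrArg (fun x => x^2) hs
    beta_reduce at h1 h2
    nlinarith [Real.sin_sq_add_cos_sq a, Real.sin_sq_add_cos_sq b, Real.sin_sq_add_cos_sq a',
      Real.sin_sq_add_cos_sq b']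
  have hd' : b - a = b' - a' := Real.injOn_cos ⟨by linarith, by linarith⟩ ⟨by linarith, by linarith⟩ hd
  have e1 : ∀ x y : ℝ, Real.cos x + Real.cos y = 2 * Real.cos ((x+y)/2) * Real.cos ((y-x)/2) := by
    intro x y
    rw [Real.cos_add_cos, ← Real.cos_neg ((x-y)/2)]; ring_nf
  rw [e1, e1, ← hd'] at hc
  have hp : 0 < Real.cos ((b-a)/2) := Real.cos_pos_of_mem_Ioo ⟨by linarith, by linarith⟩
  have hm : Real.cos ((a+b)/2) = Real.cos ((a'+b')/2) := by
    have := mul_right_cancel₀ hp.ne' hc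
    linarith
  have hm' := Real.injOn_cos ⟨by linarith, by linarith⟩ ⟨by linarith, by linarith⟩ hm
  constructor <;> linarith

noncomputable def Psi (t : ℝ) (p : ℝ × ℝ) : ℝ × ℝ :=
  (Real.cos p.1 - Real.cos t + Real.cos p.2, Real.sin p.1 - Real.sin t + Real.sin p.2)

noncomputable def dPsi (p : ℝ × ℝ) : ℝ × ℝ →L[ℝ] ℝ × ℝ :=
  LinearMap.toContinuousLinearMap (Matrix.toLin (Module.Basis.finTwoProd ℝ) (Module.Basis.finTwoProd ℝ)
    !![-Real.sin p.1, -Real.sin p.2; Real.cos p.1, Real.cos p.2])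

lemma dPsi_det (p : ℝ × ℝ) : (dPsi p).det = Real.sin (p.2 - p.1) := by
  unfold dPsi
  rw [LinearMap.det_toContinuousLinearMap, LinearMap.det_toLin, Matrix.det_fin_two_of, Real.sin_sub]
  ring

lemma Psi_hasFDerivAt (t : ℝ) (p : ℝ × ℝ) : HasFDerivAt (Psi t) (dPsi p) p := by
  unfold dPsi
  rw [Matrix.toLin_finTwoProd_toContinuousLinearMap]
  have h1 := (Real.hasDerivAt_cos p.1).comp_hasFDerivAt p (hasFDerivAt_fst (𝕜 := ℝ) (E := ℝ) (F := ℝ))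
  have h2 := (Real.hasDerivAt_cos p.2).comp_hasFDerivAt p (hasFDerivAt_snd (𝕜 := ℝ) (E := ℝ) (F := ℝ))
  have h3 := (Real.hasDerivAt_sin p.1).comp_hasFDerivAt p (hasFDerivAt_fst (𝕜 := ℝ) (E := ℝ) (F := ℝ))
  have h4 := (Real.hasDerivAt_sin p.2).comp_hasFDerivAt p (hasFDerivAt_snd (𝕜 := ℝ) (E := ℝ) (F := ℝ))
  exact ((h1.sub_const (Real.cos t)).add h2).prodMk ((h3.sub_const (Real.sin t)).add h4)

lemma cv1 {ρ t : ℝ} (S D : Set (ℝ × ℝ)) (hS : MeasurableSet S)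
    (hS2 : ∀ p ∈ S, p.1 ∈ Icc (0:ℝ) 2 ∧ p.2 ∈ Icc (0:ℝ) 2 ∧ p.2 - p.1 ≤ 1 ∧ ρ ≤ p.2 - p.1)
    (hρ : 0 < ρ) (hD : ∀ p ∈ S, Psi t p ∈ D) :
    ENNReal.ofReal (ρ / 2) * volume S ≤ volume D := by
  have inj : InjOn (Psi t) S := by
    rintro ⟨a, b⟩ h ⟨a', b'⟩ h' e
    obtain ⟨h1, h2, h3, h4⟩ := hS2 _ h
    obtain ⟨h1', h2', h3', h4'⟩ := hS2 _ h'
    simp only [Psi, Prod.mk.injEq] at *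
    exact angle_inj h1 h2 h1' h2' (by linarith) (by linarith) (by linarith) (by linarith)
  have key := lintegral_abs_det_fderiv_eq_addHaar_image volume hS
    (fun p _ => (Psi_hasFDerivAt t p).hasFDerivWithinAt) inj
  calc ENNReal.ofReal (ρ / 2) * volume S = ∫⁻ p in S, ENNReal.ofReal (ρ / 2) := by
        rw [lintegral_const, Measure.restrict_apply_univ]
    _ ≤ ∫⁻ p in S, ENNReal.ofReal |(dPsi p).det| := by
        apply setLIntegral_mono' hS
        intro p hp
        apply ENNReal.ofReal_le_ofReal
        obtain ⟨h1, h2, h3, h4⟩ := hS2 _ hp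
        rw [dPsi_det]
        refine le_trans ?_ (le_abs_self _)
        have hpi := Real.pi_gt_three
        have hpi4 := Real.pi_le_four
        have := Real.mul_le_sin (x := p.2 - p.1) (by linarith) (by linarith)
        refine le_trans ?_ this
        have h5 : 1/2 ≤ 2 / Real.pi := by
          rw [div_le_div_iff₀ (by norm_num) (by linarith)]; linarith
        calc ρ / 2 = 1/2 * ρ := by ring
          _ ≤ 2 / Real.pi * (p.2 - p.1) := mul_le_mul h5 h4 hρ.le (by linarith)
    _ = volume (Psi t '' S) := key
    _ ≤ volume D := measure_mono (by rintro _ ⟨p, hp, rfl⟩; exact hD p hp)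

lemma cv2 {ρ t : ℝ} (S D : Set (ℝ × ℝ)) (hS : MeasurableSet S)
    (hS2 : ∀ p ∈ S, p.1 ∈ Icc (0:ℝ) 2 ∧ p.2 ∈ Icc (0:ℝ) 2 ∧ |p.1 - p.2| ≤ 1 ∧ ρ ≤ |p.1 - p.2|)
    (hρ : 0 < ρ) (hD : ∀ p ∈ S, Psi t p ∈ D) :
    ENNReal.ofReal (ρ / 2) * volume S ≤ 2 * volume D := by
  have hlt : MeasurableSet {p : ℝ × ℝ | p.1 ≤ p.2} := measurableSet_le measurable_fst measurable_snd
  have hlt' : MeasurableSet {p : ℝ × ℝ | p.2 ≤ p.1} := measurableSet_le measurable_snd measurable_fst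
  have a1 := cv1 (t := t) (S ∩ {p | p.1 ≤ p.2}) D (hS.inter hlt) (by
    rintro p ⟨hp, hp' : p.1 ≤ p.2⟩
    obtain ⟨h1, h2, h3, h4⟩ := hS2 _ hp
    rw [abs_sub_comm, abs_of_nonneg (by linarith)] at h3 h4
    exact ⟨h1, h2, h3, h4⟩) hρ (fun p hp => hD p hp.1)
  have a2 := cv1 (t := t) (Prod.swap ⁻¹' (S ∩ {p | p.2 ≤ p.1})) D
    (measurable_swap (hS.inter hlt')) (by
    rintro p ⟨hp, hp' : p.1 ≤ p.2⟩
    obtain ⟨h1, h2, h3, h4⟩ := hS2 _ hp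
    simp only [Prod.fst_swap, Prod.snd_swap] at *
    rw [abs_of_nonneg (by linarith)] at h3 h4
    exact ⟨h2, h1, h3, h4⟩) hρ (fun p hp => by
      have := hD _ hp.1
      simp only [Psi, Prod.fst_swap, Prod.snd_swap] at *
      convert this using 2 <;> ring)
  have e : volume (Prod.swap ⁻¹' (S ∩ {p : ℝ × ℝ | p.2 ≤ p.1})) = volume (S ∩ {p : ℝ × ℝ | p.2 ≤ p.1}) :=
    (Measure.measurePreserving_swap (μ := (volume : Measure ℝ)) (ν := (volume : Measure ℝ))).measure_preimage
      (hS.inter hlt').nullMeasurableSet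
  rw [e] at a2
  have hu : S ⊆ (S ∩ {p | p.1 ≤ p.2}) ∪ (S ∩ {p | p.2 ≤ p.1}) := by
    intro p hp
    rcases le_total p.1 p.2 with h | h
    · exact Or.inl ⟨hp, h⟩
    · exact Or.inr ⟨hp, h⟩
  calc _ ≤ ENNReal.ofReal (ρ / 2) * (volume (S ∩ {p | p.1 ≤ p.2}) + volume (S ∩ {p | p.2 ≤ p.1})) := by
        gcongr
        exact (measure_mono hu).trans (measure_union_le _ _)
    _ ≤ volume D + volume D := by rw [mul_add]; exact add_le_add a1 a2
    _ = _ := (two_mul _).symm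


lemma slice_le {α β : Type*} [MeasureSpace α] [MeasureSpace β] [SFinite (volume : Measure β)]
    (S : Set (α × β)) (hS : MeasurableSet S) (J : Set α) (hJ : MeasurableSet J) (m : ENNReal)
    (h1 : ∀ p ∈ S, p.1 ∈ J) (h2 : ∀ x ∈ J, volume (Prod.mk x ⁻¹' S) ≤ m) :
    volume S ≤ m * volume J := by
  rw [Measure.volume_eq_prod, Measure.prod_apply hS, ← lintegral_indicator_const hJ]
  apply lintegral_mono
  intro x
  by_cases hx : x ∈ J
  · rw [indicator_of_mem hx]; exact h2 x hx
  · have : Prod.mk x ⁻¹' S = ∅ := by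
      ext y; simp only [mem_preimage, mem_empty_iff_false, iff_false]
      exact fun h => hx (h1 _ h)
    simp only [this, measure_empty, zero_le]

lemma slice_le_symm {α β : Type*} [MeasureSpace α] [MeasureSpace β] [SFinite (volume : Measure β)]
    [SFinite (volume : Measure α)]
    (S : Set (α × β)) (hS : MeasurableSet S) (J : Set β) (hJ : MeasurableSet J) (m : ENNReal)
    (h1 : ∀ p ∈ S, p.2 ∈ J) (h2 : ∀ y ∈ J, volume ((fun x => (x, y)) ⁻¹' S) ≤ m) :
    volume S ≤ m * volume J := by
  rw [Measure.volume_eq_prod, Measure.prod_apply_symm hS, ← lintegral_indicator_const hJ]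
  apply lintegral_mono
  intro x
  by_cases hx : x ∈ J
  · rw [indicator_of_mem hx]; exact h2 x hx
  · have : (fun y => (y, x)) ⁻¹' S = ∅ := by
      ext y; simp only [mem_preimage, mem_empty_iff_false, iff_false]
      exact fun h => hx (h1 _ h)
    simp only [this, measure_empty, zero_le]

lemma vol_near (t0 ℓ r x : ℝ) :
    volume (Icc t0 (t0+ℓ) ∩ {y | |y - x| ≤ r}) ≤ ENNReal.ofReal (2 * r) := by
  have : Icc t0 (t0+ℓ) ∩ {y | |y - x| ≤ r} ⊆ Icc (x - r) (x + r) := by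
    rintro y ⟨-, hy : |y - x| ≤ r⟩
    rw [abs_le] at hy
    exact ⟨by linarith, by linarith⟩
  refine (measure_mono this).trans ?_
  rw [Real.volume_Icc]
  apply ENNReal.ofReal_le_ofReal; linarith

lemma volJ {t0 ℓ δ : ℝ} (h : ℓ ≤ δ) : volume (Icc t0 (t0+ℓ)) ≤ ENNReal.ofReal δ := by
  rw [Real.volume_Icc]; apply ENNReal.ofReal_le_ofReal; linarith

lemma near12 {t0 ℓ δ r : ℝ} (h : ℓ ≤ δ) (hr : 0 ≤ r) (hδ : 0 ≤ δ) :
    volume {q : ℝ × ℝ × ℝ | q.1 ∈ Icc t0 (t0+ℓ) ∧ q.2.1 ∈ Icc t0 (t0+ℓ) ∧ q.2.2 ∈ Icc t0 (t0+ℓ) ∧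
      |q.2.1 - q.1| ≤ r} ≤ ENNReal.ofReal (2 * r * δ^2) := by
  have hm : MeasurableSet {q : ℝ × ℝ × ℝ | q.1 ∈ Icc t0 (t0+ℓ) ∧ q.2.1 ∈ Icc t0 (t0+ℓ) ∧ q.2.2 ∈ Icc t0 (t0+ℓ) ∧
      |q.2.1 - q.1| ≤ r} := by measurability
  refine (slice_le _ hm (Icc t0 (t0+ℓ)) measurableSet_Icc (ENNReal.ofReal (2 * r) * ENNReal.ofReal δ) 
    (fun p hp => hp.1) ?_).trans ?_
  · intro x hx
    have : Prod.mk x ⁻¹' {q : ℝ × ℝ × ℝ | q.1 ∈ Icc t0 (t0+ℓ) ∧ q.2.1 ∈ Icc t0 (t0+ℓ) ∧ q.2.2 ∈ Icc t0 (t0+ℓ) ∧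
      |q.2.1 - q.1| ≤ r} ⊆ (Icc t0 (t0+ℓ) ∩ {y | |y - x| ≤ r}) ×ˢ Icc t0 (t0+ℓ) := by
      rintro ⟨y, z⟩ ⟨h1, h2, h3, h4⟩
      exact ⟨⟨h2, h4⟩, h3⟩
    refine (measure_mono this).trans ?_
    rw [Measure.volume_eq_prod, Measure.prod_prod]
    exact mul_le_mul' (vol_near _ _ _ _) (volJ h)
  · calc _ ≤ ENNReal.ofReal (2 * r) * ENNReal.ofReal δ * ENNReal.ofReal δ := by gcongr; exact volJ h
      _ = _ := by rw [← ENNReal.ofReal_mul (by positivity), ← ENNReal.ofReal_mul (by positivity)]; ring_nf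

lemma near32 {t0 ℓ δ r : ℝ} (h : ℓ ≤ δ) (hr : 0 ≤ r) (hδ : 0 ≤ δ) :
    volume {q : ℝ × ℝ × ℝ | q.1 ∈ Icc t0 (t0+ℓ) ∧ q.2.1 ∈ Icc t0 (t0+ℓ) ∧ q.2.2 ∈ Icc t0 (t0+ℓ) ∧
      |q.2.2 - q.1| ≤ r} ≤ ENNReal.ofReal (2 * r * δ^2) := by
  have hm : MeasurableSet {q : ℝ × ℝ × ℝ | q.1 ∈ Icc t0 (t0+ℓ) ∧ q.2.1 ∈ Icc t0 (t0+ℓ) ∧ q.2.2 ∈ Icc t0 (t0+ℓ) ∧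
      |q.2.2 - q.1| ≤ r} := by measurability
  refine (slice_le _ hm (Icc t0 (t0+ℓ)) measurableSet_Icc (ENNReal.ofReal δ * ENNReal.ofReal (2 * r)) 
    (fun p hp => hp.1) ?_).trans ?_
  · intro x hx
    have : Prod.mk x ⁻¹' {q : ℝ × ℝ × ℝ | q.1 ∈ Icc t0 (t0+ℓ) ∧ q.2.1 ∈ Icc t0 (t0+ℓ) ∧ q.2.2 ∈ Icc t0 (t0+ℓ) ∧
      |q.2.2 - q.1| ≤ r} ⊆ Icc t0 (t0+ℓ) ×ˢ (Icc t0 (t0+ℓ) ∩ {y | |y - x| ≤ r}) := by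
      rintro ⟨y, z⟩ ⟨h1, h2, h3, h4⟩
      exact ⟨h2, ⟨h3, h4⟩⟩
    refine (measure_mono this).trans ?_
    rw [Measure.volume_eq_prod, Measure.prod_prod]
    exact mul_le_mul' (volJ h) (vol_near _ _ _ _)
  · calc _ ≤ ENNReal.ofReal δ * ENNReal.ofReal (2 * r) * ENNReal.ofReal δ := by gcongr; exact volJ h
      _ = _ := by rw [← ENNReal.ofReal_mul (by positivity), ← ENNReal.ofReal_mul (by positivity)]; ring_nf

lemma near13 {t0 ℓ δ r : ℝ} (h : ℓ ≤ δ) (hr : 0 ≤ r) (hδ : 0 ≤ δ) :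
    volume {q : ℝ × ℝ × ℝ | q.1 ∈ Icc t0 (t0+ℓ) ∧ q.2.1 ∈ Icc t0 (t0+ℓ) ∧ q.2.2 ∈ Icc t0 (t0+ℓ) ∧
      |q.2.1 - q.2.2| ≤ r} ≤ ENNReal.ofReal (2 * r * δ^2) := by
  have hm : MeasurableSet {q : ℝ × ℝ × ℝ | q.1 ∈ Icc t0 (t0+ℓ) ∧ q.2.1 ∈ Icc t0 (t0+ℓ) ∧ q.2.2 ∈ Icc t0 (t0+ℓ) ∧
      |q.2.1 - q.2.2| ≤ r} := by measurability
  refine (slice_le_symm _ hm (Icc t0 (t0+ℓ) ×ˢ Icc t0 (t0+ℓ) ∩ {p | |p.1 - p.2| ≤ r}) 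
    (by measurability) (ENNReal.ofReal δ) 
    (fun p hp => ⟨⟨hp.2.1, hp.2.2.1⟩, hp.2.2.2⟩) ?_).trans ?_
  · rintro y -
    refine (measure_mono ?_).trans (volJ (t0 := t0) h)
    exact fun x hx => hx.1
  · have : volume (Icc t0 (t0+ℓ) ×ˢ Icc t0 (t0+ℓ) ∩ {p : ℝ × ℝ | |p.1 - p.2| ≤ r}) ≤ ENNReal.ofReal (2 * r) * volume (Icc t0 (t0+ℓ)) := by
      apply slice_le_symm _ (by measurability) _ measurableSet_Icc _ (fun p hp => hp.1.2)
      intro y _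
      refine (measure_mono ?_).trans (vol_near t0 ℓ r y)
      exact fun x hx => ⟨hx.1.1, hx.2⟩
    calc _ ≤ ENNReal.ofReal δ * (ENNReal.ofReal (2 * r) * ENNReal.ofReal δ) := by
          gcongr; exact this.trans (by gcongr; exact volJ h)
      _ = _ := by rw [← ENNReal.ofReal_mul (by positivity), ← ENNReal.ofReal_mul (by positivity)]; ring_nf

lemma vol_of_dist (S : Set ℝ) (r : ℝ) (h : ∀ x ∈ S, ∀ y ∈ S, |x - y| ≤ r) :
    volume S ≤ ENNReal.ofReal r := by
  refine (Real.volume_le_diam S).trans ?_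
  apply Metric.ediam_le
  intro x hx y hy
  rw [edist_dist, Real.dist_eq]
  exact ENNReal.ofReal_le_ofReal (h x hx y hy)

/-- the set of pairs of middle angle and endpoint -/
def DD (h δ t0 ℓ η b : ℝ) (a : ℝ × ℝ → ℝ) : Set (ℝ × ℝ × ℝ) :=
  {q | q.1 ∈ Icc t0 (t0+ℓ) ∧
    q.2 ∈ Icc (Real.cos t0 - 6 * δ^2) (Real.cos t0 + 6 * δ^2) ×ˢ Icc (Real.sin t0 - 3 * δ) (Real.sin t0 + 3 * δ) ∧
    |q.2.1| ≤ 3 ∧ |q.2.2| ≤ 3 ∧ |q.2.1 - Real.cos t0| < h ∧ |q.2.2 - Real.sin t0| < h ∧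
    η^2 * δ^2 / 4 ≤ |kap q.2.1 q.2.2| ∧
    |a q.2 * ff q.2.1 q.2.2 q.1 + b * gg q.2.1 q.2.2 q.1| ≤ 24 * δ^2 * η^4}

lemma DD_meas (h δ t0 ℓ η b : ℝ) (a : ℝ × ℝ → ℝ) (ha : Measurable a) :
    MeasurableSet (DD h δ t0 ℓ η b a) := by
  have h1 : Measurable fun q : ℝ × ℝ × ℝ => kap q.2.1 q.2.2 := by unfold kap; fun_prop
  have h2 : Measurable fun q : ℝ × ℝ × ℝ => ff q.2.1 q.2.2 q.1 := by
    unfold ff RR uu kap; fun_prop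
  have h3 : Measurable fun q : ℝ × ℝ × ℝ => gg q.2.1 q.2.2 q.1 := by
    unfold gg RR vv kap; fun_prop
  have h4 : Measurable fun q : ℝ × ℝ × ℝ => |a q.2 * ff q.2.1 q.2.2 q.1 + b * gg q.2.1 q.2.2 q.1| := by
    fun_prop
  have h5 : Measurable fun q : ℝ × ℝ × ℝ => |kap q.2.1 q.2.2| := by fun_prop
  have m1 := measurableSet_le h4 (measurable_const (a := 24 * δ^2 * η^4))
  have m2 := measurableSet_le (measurable_const (a := η^2 * δ^2 / 4)) h5
  unfold DD
  measurability

lemma DD_vol {c₁ h δ t0 ℓ η b : ℝ} {a : ℝ × ℝ → ℝ} (ha : Measurable a) (hc₁ : 0 < c₁)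
    (hh : ∀ t0 ∈ Icc (0:ℝ) 2, ∀ X Y t τ : ℝ,
    |X - Real.cos t0| < h → |Y - Real.sin t0| < h → |t - t0| < h → |τ - t0| < h →
    1 ≤ dM X Y t τ) (hδ : 0 < δ) (hδ1 : δ ≤ 1) (ht0 : δ ≤ t0) (ht1 : t0 + ℓ ≤ 2 * δ) (hl : 0 ≤ ℓ)
    (hlh : ℓ < h) (hη : 0 < η) (hac : ∀ z, c₁ ≤ |a z|) :
    volume (DD h δ t0 ℓ η b a) ≤ ENNReal.ofReal (115200 / c₁ * δ * η^2 * (72 * δ^3)) := by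
  refine (slice_le_symm _ (DD_meas h δ t0 ℓ η b a ha)
    (Icc (Real.cos t0 - 6 * δ^2) (Real.cos t0 + 6 * δ^2) ×ˢ Icc (Real.sin t0 - 3 * δ) (Real.sin t0 + 3 * δ))
    (measurableSet_Icc.prod measurableSet_Icc) (ENNReal.ofReal (115200 / c₁ * δ * η^2))
    (fun p hp => hp.2.1) ?_).trans ?_
  · rintro ⟨X, Y⟩ -
    apply vol_of_dist
    rintro t ⟨ht, -, hX, hY, hX', hY', hk, hE⟩ τ ⟨hτ, -, -, -, -, -, -, hE'⟩
    dsimp only at *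
    have hM : |t - τ| ≤ |MM X Y t τ| := by
      refine MM_lower (a := t0) (b := t0 + ℓ) ?_ ht hτ
      intro t ht τ hτ
      refine hh t0 ⟨by linarith, by linarith⟩ X Y t τ hX' hY' ?_ ?_
      · rw [abs_of_nonneg (by linarith [ht.1])]; linarith [ht.2]
      · rw [abs_of_nonneg (by linarith [hτ.1])]; linarith [hτ.2]
    have g1 : |gg X Y t| ≤ 600 * δ := gg_bound hX hY (by
      rw [abs_of_nonneg (by linarith [ht.1])]; linarith [ht.2])
    have g2 : |gg X Y τ| ≤ 600 * δ := gg_bound hX hY (by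
      rw [abs_of_nonneg (by linarith [hτ.1])]; linarith [hτ.2])
    have e : a (X, Y) * (kap X Y * MM X Y t τ) =
      (a (X,Y) * ff X Y t + b * gg X Y t) * gg X Y τ - (a (X,Y) * ff X Y τ + b * gg X Y τ) * gg X Y t := by
      rw [← fg_eq]; ring
    have e2 : |a (X, Y) * (kap X Y * MM X Y t τ)| ≤ 28800 * δ^3 * η^4 := by
      rw [e]
      refine (abs_sub _ _).trans ?_
      rw [abs_mul, abs_mul]
      have p1 := mul_le_mul hE g2 (abs_nonneg _) (by positivity)
      have p2 := mul_le_mul hE' g1 (abs_nonneg _) (by positivity)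
      linarith
    rw [abs_mul, abs_mul] at e2
    have e3 : c₁ * (η^2 * δ^2 / 4 * |t - τ|) ≤ |a (X, Y)| * (|kap X Y| * |MM X Y t τ|) := by
      have := hac (X, Y)
      gcongr
    have e4 := e3.trans e2
    have e5 : 115200 / c₁ * δ * η^2 = (28800 * δ^3 * η^4) / (c₁ * (η^2 * δ^2 / 4)) := by
      field_simp; ring
    rw [e5, le_div_iff₀ (by positivity)]
    linarith
  · rw [Measure.volume_eq_prod, Measure.prod_prod, Real.volume_Icc, Real.volume_Icc,
      ← ENNReal.ofReal_mul (by nlinarith [sq_nonneg δ]), ← ENNReal.ofReal_mul (by positivity)]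
    apply ENNReal.ofReal_le_ofReal
    apply le_of_eq; ring


def TT (δ t0 ℓ η b : ℝ) (a : ℝ × ℝ → ℝ) : Set (ℝ × ℝ × ℝ) :=
  {q | q.1 ∈ Icc t0 (t0+ℓ) ∧ q.2.1 ∈ Icc t0 (t0+ℓ) ∧ q.2.2 ∈ Icc t0 (t0+ℓ) ∧
    |a (Psi q.1 q.2) * (Real.sin q.2.1 * Real.cos q.1 * Real.sin q.2.2)
      + b * (Real.cos q.2.1 * Real.sin q.1 * Real.cos q.2.2)| ≤ 6 * δ^2 * η^4}

lemma TT_meas (δ t0 ℓ η b : ℝ) (a : ℝ × ℝ → ℝ) (ha : Measurable a) :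
    MeasurableSet (TT δ t0 ℓ η b a) := by
  have h0 : Measurable fun q : ℝ × ℝ × ℝ => Psi q.1 q.2 := by unfold Psi; fun_prop
  have h1 : Measurable fun q : ℝ × ℝ × ℝ => |a (Psi q.1 q.2) * (Real.sin q.2.1 * Real.cos q.1 * Real.sin q.2.2)
      + b * (Real.cos q.2.1 * Real.sin q.1 * Real.cos q.2.2)| := by
    have := ha.comp h0
    simp only [Function.comp_def] at this
    fun_prop
  have m1 := measurableSet_le h1 (measurable_const (a := 6 * δ^2 * η^4))
  unfold TT
  measurability

lemma cos_diff {δ a b : ℝ} (ha : a ∈ Icc δ (2*δ)) (hb : b ∈ Icc δ (2*δ)) :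
    |Real.cos a - Real.cos b| ≤ 2 * δ^2 := by
  obtain ⟨a1, a2⟩ := ha
  obtain ⟨b1, b2⟩ := hb
  rw [Real.cos_sub_cos, abs_mul, abs_mul]
  have h1 : |Real.sin ((a+b)/2)| ≤ 2 * δ := by
    refine Real.abs_sin_le_abs.trans ?_
    rw [abs_of_nonneg (by linarith)]; linarith
  have h2 : |Real.sin ((a-b)/2)| ≤ δ/2 := by
    refine Real.abs_sin_le_abs.trans ?_
    rw [abs_le]; constructor <;> linarith
  have := mul_le_mul h1 h2 (abs_nonneg _) (by linarith)
  have e : |(-2:ℝ)| = 2 := by norm_num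
  rw [e]
  nlinarith

lemma cos_lip (a b : ℝ) : |Real.cos a - Real.cos b| ≤ |a - b| := by
  rw [Real.cos_sub_cos, abs_mul, abs_mul]
  have h1 := Real.abs_sin_le_one ((a+b)/2)
  have h2 : |Real.sin ((a-b)/2)| ≤ |a-b|/2 := by
    refine Real.abs_sin_le_abs.trans ?_
    rw [abs_div]; norm_num
  have := mul_le_mul h1 h2 (abs_nonneg _) (by linarith)
  have e : |(-2:ℝ)| = 2 := by norm_num
  rw [e]
  nlinarith

lemma sin_lip (a b : ℝ) : |Real.sin a - Real.sin b| ≤ |a - b| := by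
  rw [Real.sin_sub_sin, abs_mul, abs_mul]
  have h1 := Real.abs_cos_le_one ((a+b)/2)
  have h2 : |Real.sin ((a-b)/2)| ≤ |a-b|/2 := by
    refine Real.abs_sin_le_abs.trans ?_
    rw [abs_div]; norm_num
  have := mul_le_mul h2 h1 (abs_nonneg _) (by positivity)
  have e : |(2:ℝ)| = 2 := by norm_num
  rw [e]
  nlinarith

lemma kap_lower {t1 t2 t3 r : ℝ} (hr : 0 ≤ r) (h12 : r ≤ |t1 - t2|) (h32 : r ≤ |t3 - t2|)
    (h12' : |t1 - t2| ≤ 1) (h32' : |t3 - t2| ≤ 1) (h13 : |t1 - t3| ≤ 1) :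
    r^2 / 4 ≤ |kap (Real.cos t1 - Real.cos t2 + Real.cos t3) (Real.sin t1 - Real.sin t2 + Real.sin t3)| := by
  have hpi := Real.pi_gt_three
  have hpi4 := Real.pi_le_four
  have key : ∀ x : ℝ, r ≤ |x| → |x| ≤ 1 → r / 4 ≤ |Real.sin (x/2)| := by
    intro x h1 h2
    have e : |x/2| = |x|/2 := by rw [abs_div]; norm_num
    have := Real.mul_abs_le_abs_sin (x := x/2) (by rw [e]; linarith)
    refine le_trans ?_ this
    rw [e]
    have h5 : 1/2 ≤ 2 / Real.pi := by
      rw [div_le_div_iff₀ (by norm_num) (by linarith)]; linarith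
    calc r / 4 = 1/2 * (r/2) := by ring
      _ ≤ _ := mul_le_mul h5 (by linarith) (by linarith) (by positivity)
  have hc : 1/2 ≤ |Real.cos ((t1 - t3)/2)| := by
    refine le_trans ?_ (le_abs_self _)
    have := Real.one_sub_sq_div_two_le_cos (x := (t1 - t3)/2)
    have h2 : (t1 - t3)^2 ≤ 1 := by rw [← sq_abs]; nlinarith [abs_nonneg (t1 - t3)]
    nlinarith
  rw [kap_eq, abs_mul, abs_mul, abs_mul]
  have k1 := key _ h12 h12'
  have k2 := key _ h32 h32'
  have e : |(8:ℝ)| = 8 := by norm_num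
  rw [e]
  calc r^2/4 = 8 * (1/2) * (r/4) * (r/4) := by ring
    _ ≤ _ := by gcongr

lemma Psi_mem_DD {h δ t0 ℓ η b : ℝ} {a : ℝ × ℝ → ℝ}
    (hδ : 0 < δ) (hδ1 : δ ≤ 1) (ht0 : δ ≤ t0) (ht1 : t0 + ℓ ≤ 2 * δ) (hl : 0 ≤ ℓ)
    (hlh : ℓ ≤ h / 4) (hh : 0 < h) (hη : 0 < η) {t : ℝ} {p : ℝ × ℝ}
    (hT : (t, p) ∈ TT δ t0 ℓ η b a) (h12 : η * δ ≤ |p.1 - t|) (h32 : η * δ ≤ |p.2 - t|) :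
    (t, Psi t p) ∈ DD h δ t0 ℓ η b a := by
  obtain ⟨t1, t3⟩ := p
  obtain ⟨ht, h1, h3, hE⟩ := hT
  dsimp only at *
  have hd : ∀ x ∈ Icc t0 (t0+ℓ), ∀ y ∈ Icc t0 (t0+ℓ), |x - y| ≤ ℓ := by
    rintro x ⟨x1, x2⟩ y ⟨y1, y2⟩
    rw [abs_le]; constructor <;> linarith
  have hb : ∀ x ∈ Icc t0 (t0+ℓ), x ∈ Icc δ (2*δ) := by
    rintro x ⟨x1, x2⟩
    exact ⟨by linarith, by linarith⟩
  have ht00 : t0 ∈ Icc t0 (t0+ℓ) := ⟨le_rfl, by linarith⟩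
  have hlδ : ℓ ≤ δ := by linarith
  have c1 := abs_le.1 (cos_diff (hb _ h1) (hb _ ht00))
  have c2 := abs_le.1 (cos_diff (hb _ ht) (hb _ ht00))
  have c3 := abs_le.1 (cos_diff (hb _ h3) (hb _ ht00))
  have s1 := abs_le.1 ((sin_lip t1 t0).trans (hd _ h1 _ ht00))
  have s2 := abs_le.1 ((sin_lip t t0).trans (hd _ ht _ ht00))
  have s3 := abs_le.1 ((sin_lip t3 t0).trans (hd _ h3 _ ht00))
  have d1 := abs_le.1 ((cos_lip t1 t0).trans (hd _ h1 _ ht00))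
  have d2 := abs_le.1 ((cos_lip t t0).trans (hd _ ht _ ht00))
  have d3 := abs_le.1 ((cos_lip t3 t0).trans (hd _ h3 _ ht00))
  refine ⟨ht, ⟨⟨?_, ?_⟩, ⟨?_, ?_⟩⟩, ?_, ?_, ?_, ?_, ?_, ?_⟩
  · simp only [Psi]; linarith
  · simp only [Psi]; linarith
  · simp only [Psi]; linarith
  · simp only [Psi]; linarith
  · simp only [Psi]; rw [abs_le]
    constructor <;> linarith [Real.cos_le_one t1, Real.cos_le_one t, Real.cos_le_one t3,
      Real.neg_one_le_cos t1, Real.neg_one_le_cos t, Real.neg_one_le_cos t3]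
  · simp only [Psi]; rw [abs_le]
    constructor <;> linarith [Real.sin_le_one t1, Real.sin_le_one t, Real.sin_le_one t3,
      Real.neg_one_le_sin t1, Real.neg_one_le_sin t, Real.neg_one_le_sin t3]
  · simp only [Psi]; rw [abs_lt]; constructor <;> linarith
  · simp only [Psi]; rw [abs_lt]; constructor <;> linarith
  · simp only [Psi]
    have := kap_lower (by positivity) h12 h32 ((hd _ h1 _ ht).trans (by linarith))
      ((hd _ h3 _ ht).trans (by linarith)) ((hd _ h1 _ h3).trans (by linarith))
    rw [mul_pow] at this
    exact this
  · simp only [Psi] at hE ⊢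
    rw [ff_eq, gg_eq]
    set R := RR (Real.cos t1 - Real.cos t + Real.cos t3) (Real.sin t1 - Real.sin t + Real.sin t3) t with hR
    have hR4 : |R| ≤ 4 := by
      rw [hR, RR_eq, ← Real.cos_sub, abs_le]
      constructor <;> linarith [Real.cos_le_one (t1 - t3), Real.neg_one_le_cos (t1 - t3)]
    have := mul_le_mul hR4 hE (abs_nonneg _) (by norm_num)
    rw [← abs_mul] at this
    calc _ = _ := by congr 1; ring
      _ ≤ _ := this
      _ = _ := by ring

lemma TT_vol {c₁ h δ t0 ℓ η b : ℝ} {a : ℝ × ℝ → ℝ} (ha : Measurable a) (hc₁ : 0 < c₁)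
    (hh0 : 0 < h)
    (hh : ∀ t0 ∈ Icc (0:ℝ) 2, ∀ X Y t τ : ℝ,
    |X - Real.cos t0| < h → |Y - Real.sin t0| < h → |t - t0| < h → |τ - t0| < h →
    1 ≤ dM X Y t τ) (hδ : 0 < δ) (hδ1 : δ ≤ 1) (ht0 : δ ≤ t0) (ht1 : t0 + ℓ ≤ 2 * δ) (hl : 0 ≤ ℓ)
    (hlh : ℓ ≤ h / 4) (hη : 0 < η) (hac : ∀ z, c₁ ≤ |a z|) :
    volume (TT δ t0 ℓ η b a) ≤ ENNReal.ofReal ((6 + 4 * 115200 / c₁ * 72) * δ^3 * η) := by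
  have hlδ : ℓ ≤ δ := by linarith
  have hr : 0 ≤ η * δ := by positivity
  set T' : Set (ℝ × ℝ × ℝ) := TT δ t0 ℓ η b a ∩
    {q | η * δ ≤ |q.2.1 - q.1| ∧ η * δ ≤ |q.2.2 - q.1| ∧ η * δ ≤ |q.2.1 - q.2.2|} with hT'
  have mT' : MeasurableSet T' := (TT_meas δ t0 ℓ η b a ha).inter (by measurability)
  have hsub : TT δ t0 ℓ η b a ⊆ (({q : ℝ × ℝ × ℝ | q.1 ∈ Icc t0 (t0+ℓ) ∧ q.2.1 ∈ Icc t0 (t0+ℓ) ∧ q.2.2 ∈ Icc t0 (t0+ℓ) ∧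
      |q.2.1 - q.1| ≤ η * δ} ∪ {q : ℝ × ℝ × ℝ | q.1 ∈ Icc t0 (t0+ℓ) ∧ q.2.1 ∈ Icc t0 (t0+ℓ) ∧ q.2.2 ∈ Icc t0 (t0+ℓ) ∧
      |q.2.2 - q.1| ≤ η * δ}) ∪ {q : ℝ × ℝ × ℝ | q.1 ∈ Icc t0 (t0+ℓ) ∧ q.2.1 ∈ Icc t0 (t0+ℓ) ∧ q.2.2 ∈ Icc t0 (t0+ℓ) ∧
      |q.2.1 - q.2.2| ≤ η * δ}) ∪ T' := by
    intro q hq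
    by_cases h1 : |q.2.1 - q.1| ≤ η * δ
    · exact Or.inl (Or.inl (Or.inl ⟨hq.1, hq.2.1, hq.2.2.1, h1⟩))
    by_cases h2 : |q.2.2 - q.1| ≤ η * δ
    · exact Or.inl (Or.inl (Or.inr ⟨hq.1, hq.2.1, hq.2.2.1, h2⟩))
    by_cases h3 : |q.2.1 - q.2.2| ≤ η * δ
    · exact Or.inl (Or.inr ⟨hq.1, hq.2.1, hq.2.2.1, h3⟩)
    push Not at h1 h2 h3
    exact Or.inr ⟨hq, h1.le, h2.le, h3.le⟩
  have hvT' : ENNReal.ofReal (η * δ / 2) * volume T' ≤ 2 * volume (DD h δ t0 ℓ η b a) := by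
    have mD := DD_meas h δ t0 ℓ η b a ha
    rw [Measure.volume_eq_prod, Measure.prod_apply mT', Measure.prod_apply mD,
      ← lintegral_const_mul _ (measurable_measure_prodMk_left mT'),
      ← lintegral_const_mul _ (measurable_measure_prodMk_left mD)]
    apply lintegral_mono
    intro t
    refine cv2 (t := t) _ _ (measurable_prodMk_left mT') ?_ (by positivity) ?_
    · rintro ⟨t1, t3⟩ ⟨⟨g0, ⟨g1, g2⟩, ⟨g3, g4⟩, -⟩, -, -, g5⟩
      dsimp only at *
      refine ⟨⟨by linarith, by linarith⟩, ⟨by linarith, by linarith⟩, ?_, g5⟩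
      rw [abs_le]; constructor <;> linarith
    · rintro p ⟨g0, g1, g2, -⟩
      exact Psi_mem_DD hδ hδ1 ht0 ht1 hl hlh hh0 hη g0 g1 g2
  have hD := DD_vol (b := b) ha hc₁ hh hδ hδ1 ht0 ht1 hl (by linarith) hη hac
  have hvT2 : volume T' ≤ ENNReal.ofReal (4 * 115200 / c₁ * 72 * δ^3 * η) := by
    have e : ENNReal.ofReal (η * δ / 2) * volume T' ≤
        ENNReal.ofReal (η * δ / 2) * ENNReal.ofReal (4 * 115200 / c₁ * 72 * δ^3 * η) := by
      refine hvT'.trans ?_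
      calc _ ≤ ENNReal.ofReal 2 * ENNReal.ofReal (115200 / c₁ * δ * η^2 * (72 * δ^3)) := by
            rw [ENNReal.ofReal_ofNat]; gcongr
        _ = _ := by
            rw [← ENNReal.ofReal_mul (by positivity), ← ENNReal.ofReal_mul (by positivity)]
            congr 1; ring
    rwa [ENNReal.mul_le_mul_iff_right] at e
    · simp only [ne_eq, ENNReal.ofReal_eq_zero, not_le]; positivity
    · exact ENNReal.ofReal_ne_top
  refine (measure_mono hsub).trans ?_
  refine (measure_union_le _ _).trans ?_
  refine (add_le_add ((measure_union_le _ _).trans (add_le_add ((measure_union_le _ _).trans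
    (add_le_add (near12 hlδ hr hδ.le) (near32 hlδ hr hδ.le))) (near13 hlδ hr hδ.le))) hvT2).trans ?_
  rw [← ENNReal.ofReal_add (by positivity) (by positivity), ← ENNReal.ofReal_add (by positivity) (by positivity),
    ← ENNReal.ofReal_add (by positivity) (by positivity)]
  apply ENNReal.ofReal_le_ofReal
  apply le_of_eq; ring


lemma shift {F : (ℝ × ℝ) × ℝ → ENNReal} (hF : Measurable F) {w : ℝ → ℝ × ℝ} (hw : Measurable w) :
    ∫⁻ p, F p = ∫⁻ z, ∫⁻ t, F (z - w t, t) := by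
  rw [Measure.volume_eq_prod, lintegral_prod_symm _ hF.aemeasurable]
  have e : ∀ t : ℝ, ∫⁻ z : ℝ × ℝ, F (z, t) = ∫⁻ z : ℝ × ℝ, F (z - w t, t) := by
    intro t
    exact (lintegral_sub_right_eq_self (fun z => F (z, t)) (w t)).symm
  simp_rw [e]
  refine lintegral_lintegral_swap (f := fun t z => F (z - w t, t)) ?_
  apply Measurable.aemeasurable
  apply hF.comp
  fun_prop

/-- degree function -/
noncomputable def dg (χ : (ℝ × ℝ) × ℝ → ENNReal) (w : ℝ → ℝ × ℝ) (z : ℝ × ℝ) : ENNReal :=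
  ∫⁻ t, χ (z - w t, t)

lemma dg_meas {χ : (ℝ × ℝ) × ℝ → ENNReal} (hχ : Measurable χ) {w : ℝ → ℝ × ℝ} (hw : Measurable w) :
    Measurable (dg χ w) := by
  have : Measurable fun q : (ℝ × ℝ) × ℝ => χ (q.1 - w q.2, q.2) := by
    apply hχ.comp; fun_prop
  exact this.lintegral_prod_right'

lemma shift_mul {χ : (ℝ × ℝ) × ℝ → ENNReal} (hχ : Measurable χ) {w : ℝ → ℝ × ℝ} (hw : Measurable w)
    {G : ℝ × ℝ → ENNReal} (hG : Measurable G) :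
    ∫⁻ p : (ℝ × ℝ) × ℝ, χ p * G (p.1 + w p.2) = ∫⁻ z, dg χ w z * G z := by
  rw [shift (F := fun p => χ p * G (p.1 + w p.2)) (by
    apply hχ.mul; apply hG.comp; fun_prop) hw]
  apply lintegral_congr
  intro z
  simp only [sub_add_cancel]
  rw [lintegral_mul_const]
  · rfl
  · apply hχ.comp; fun_prop

lemma low_level {χ : (ℝ × ℝ) × ℝ → ENNReal} (hχ : Measurable χ) {w : ℝ → ℝ × ℝ} (hw : Measurable w)
    (B : Set (ℝ × ℝ)) (hB : MeasurableSet B) (hs : ∀ z, z ∉ B → dg χ w z = 0) (θ : ENNReal) :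
    ∫⁻ p : (ℝ × ℝ) × ℝ, χ p * {z | dg χ w z < θ}.indicator 1 (p.1 + w p.2) ≤ θ * volume B := by
  have hm : MeasurableSet {z | dg χ w z < θ} := measurableSet_lt (dg_meas hχ hw) measurable_const
  rw [shift_mul hχ hw (measurable_one.indicator hm), ← lintegral_indicator_const hB]
  apply lintegral_mono
  intro z
  beta_reduce
  by_cases hz : z ∈ B
  · rw [indicator_of_mem hz]
    by_cases h : z ∈ {z | dg χ w z < θ}
    · rw [indicator_of_mem h]; simpa using le_of_lt h
    · rw [indicator_of_notMem h]; simp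
  · rw [hs z hz]; simp

lemma refine_lower {χ : (ℝ × ℝ) × ℝ → ENNReal} (hχ : Measurable χ) {w1 w2 : ℝ → ℝ × ℝ}
    (hw1 : Measurable w1) (hw2 : Measurable w2)
    (B1 B2 : Set (ℝ × ℝ)) (hB1 : MeasurableSet B1) (hs1 : ∀ z, z ∉ B1 → dg χ w1 z = 0)
    (hB2 : MeasurableSet B2) (hs2 : ∀ z, z ∉ B2 → dg χ w2 z = 0) (θ : ENNReal) :
    θ^2 * ∫⁻ p, χ p ≤ θ^2 * (θ * volume B1 + θ * volume B2) +
      ∫⁻ p : (ℝ × ℝ) × ℝ, χ p * (dg χ w1 (p.1 + w1 p.2) * dg χ w2 (p.1 + w2 p.2)) := by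
  have hm1 : MeasurableSet {z | dg χ w1 z < θ} := measurableSet_lt (dg_meas hχ hw1) measurable_const
  have hm2 : MeasurableSet {z | dg χ w2 z < θ} := measurableSet_lt (dg_meas hχ hw2) measurable_const
  have l1 := low_level hχ hw1 B1 hB1 hs1 θ
  have l2 := low_level hχ hw2 B2 hB2 hs2 θ
  have M1 : Measurable fun p : (ℝ × ℝ) × ℝ => χ p * {z | dg χ w1 z < θ}.indicator 1 (p.1 + w1 p.2) := by
    apply hχ.mul
    exact (measurable_one.indicator hm1).comp (by fun_prop)
  have M2 : Measurable fun p : (ℝ × ℝ) × ℝ => χ p * {z | dg χ w2 z < θ}.indicator 1 (p.1 + w2 p.2) := by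
    apply hχ.mul
    exact (measurable_one.indicator hm2).comp (by fun_prop)
  have M12 : Measurable fun p : (ℝ × ℝ) × ℝ =>
      (χ p * {z | dg χ w1 z < θ}.indicator 1 (p.1 + w1 p.2)
        + χ p * {z | dg χ w2 z < θ}.indicator 1 (p.1 + w2 p.2)) := M1.add M2
  have M3 : Measurable fun p : (ℝ × ℝ) × ℝ =>
      θ^2 * (χ p * {z | dg χ w1 z < θ}.indicator 1 (p.1 + w1 p.2)
        + χ p * {z | dg χ w2 z < θ}.indicator 1 (p.1 + w2 p.2)) := M12.const_mul _
  calc θ^2 * ∫⁻ p, χ p = ∫⁻ p, θ^2 * χ p := (lintegral_const_mul _ hχ).symm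
    _ ≤ ∫⁻ p : (ℝ × ℝ) × ℝ, (θ^2 * (χ p * {z | dg χ w1 z < θ}.indicator 1 (p.1 + w1 p.2)
          + χ p * {z | dg χ w2 z < θ}.indicator 1 (p.1 + w2 p.2)) +
        χ p * (dg χ w1 (p.1 + w1 p.2) * dg χ w2 (p.1 + w2 p.2))) := by
        apply lintegral_mono
        intro p
        beta_reduce
        by_cases h1 : p.1 + w1 p.2 ∈ {z | dg χ w1 z < θ}
        · rw [indicator_of_mem h1]
          simp only [Pi.one_apply, mul_one, mul_add, add_assoc]
          exact le_self_add
        by_cases h2 : p.1 + w2 p.2 ∈ {z | dg χ w2 z < θ}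
        · rw [indicator_of_mem h2]
          simp only [Pi.one_apply, mul_one, mul_add]
          exact le_trans le_add_self le_self_add
        · have h1' : θ ≤ dg χ w1 (p.1 + w1 p.2) := not_lt.1 h1
          have h2' : θ ≤ dg χ w2 (p.1 + w2 p.2) := not_lt.1 h2
          refine le_trans ?_ le_add_self
          rw [mul_comm, sq]
          gcongr
    _ = θ^2 * ((∫⁻ p : (ℝ × ℝ) × ℝ, χ p * {z | dg χ w1 z < θ}.indicator 1 (p.1 + w1 p.2))
          + ∫⁻ p : (ℝ × ℝ) × ℝ, χ p * {z | dg χ w2 z < θ}.indicator 1 (p.1 + w2 p.2)) +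
        ∫⁻ p : (ℝ × ℝ) × ℝ, χ p * (dg χ w1 (p.1 + w1 p.2) * dg χ w2 (p.1 + w2 p.2)) := by
        rw [lintegral_add_left M3, lintegral_const_mul _ M12, lintegral_add_left M1]
    _ ≤ _ := by gcongr

lemma path_eq {χ : (ℝ × ℝ) × ℝ → ENNReal} (hχ : Measurable χ) {w1 w2 : ℝ → ℝ × ℝ}
    (hw1 : Measurable w1) (hw2 : Measurable w2) :
    ∫⁻ p : (ℝ × ℝ) × ℝ, χ p * (dg χ w1 (p.1 + w1 p.2) * dg χ w2 (p.1 + w2 p.2)) =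
    ∫⁻ z, ∫⁻ t1, ∫⁻ t2, ∫⁻ t3, χ (z - w1 t1, t1) * (χ (z - w1 t1 + w2 t1 - w2 t2, t2)
       * χ (z - w1 t1 + w2 t1 - w2 t2 + w1 t2 - w1 t3, t3)) := by
  have hd1 := dg_meas hχ hw1
  have hd2 := dg_meas hχ hw2
  set H : ℝ × ℝ → ENNReal := fun z => ∫⁻ t, χ (z - w2 t, t) * dg χ w1 (z - w2 t + w1 t) with hH
  have hHm' : Measurable fun q : (ℝ × ℝ) × ℝ => χ (q.1 - w2 q.2, q.2) * dg χ w1 (q.1 - w2 q.2 + w1 q.2) := by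
    apply Measurable.mul
    · apply hχ.comp; fun_prop
    · apply hd1.comp; fun_prop
  have hHm : Measurable H := hHm'.lintegral_prod_right'
  have s1 : ∫⁻ p : (ℝ × ℝ) × ℝ, χ p * (dg χ w1 (p.1 + w1 p.2) * dg χ w2 (p.1 + w2 p.2)) =
      ∫⁻ z, dg χ w2 z * H z := by
    rw [shift (F := fun p : (ℝ × ℝ) × ℝ => χ p * (dg χ w1 (p.1 + w1 p.2) * dg χ w2 (p.1 + w2 p.2))) (by
      apply hχ.mul; apply Measurable.mul
      · apply hd1.comp; fun_prop
      · apply hd2.comp; fun_prop) hw2]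
    apply lintegral_congr
    intro z
    simp only [sub_add_cancel, ← mul_assoc]
    rw [lintegral_mul_const, mul_comm]
    exact hHm'.comp measurable_prodMk_left
  rw [s1, ← shift_mul hχ hw2 hHm, shift (F := fun p : (ℝ × ℝ) × ℝ => χ p * H (p.1 + w2 p.2)) (by
    apply hχ.mul; apply hHm.comp; fun_prop) hw1]
  apply lintegral_congr; intro z
  apply lintegral_congr; intro t1
  simp only [hH, dg]
  have m1 : ∀ y : ℝ × ℝ, Measurable fun t2 => χ (y - w2 t2, t2) * ∫⁻ t, χ (y - w2 t2 + w1 t2 - w1 t, t) :=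
    fun y => hHm'.comp (measurable_prodMk_left (x := y))
  rw [← lintegral_const_mul _ (m1 _)]
  apply lintegral_congr; intro t2
  rw [← lintegral_const_mul, ← lintegral_const_mul]
  · apply Measurable.const_mul; apply hχ.comp; fun_prop
  · apply hχ.comp; fun_prop

noncomputable def W1 (t : ℝ) : ℝ × ℝ := (0, Real.sin t)
noncomputable def W2 (t : ℝ) : ℝ × ℝ := (Real.cos t, 0)

lemma W1_meas : Measurable W1 := by unfold W1; fun_prop
lemma W2_meas : Measurable W2 := by unfold W2; fun_prop

lemma piece {c₁ h δ t0 ℓ ω : ℝ} {α β : ℝ × ℝ → ℝ} (hα : Measurable α) (hc₁ : 0 < c₁)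
    (hh0 : 0 < h)
    (hh : ∀ t0 ∈ Icc (0:ℝ) 2, ∀ X Y t τ : ℝ,
    |X - Real.cos t0| < h → |Y - Real.sin t0| < h → |t - t0| < h → |τ - t0| < h →
    1 ≤ dM X Y t τ) (hδ : 0 < δ) (hδ1 : δ ≤ 1) (ht0 : δ ≤ t0) (ht1 : t0 + ℓ ≤ 2 * δ) (hl : 0 ≤ ℓ)
    (hlh : ℓ ≤ h / 4) (hω : 0 < ω) (hac : ∀ z, c₁ ≤ |α z|)
    (E : Set ((ℝ × ℝ) × ℝ)) (hE : MeasurableSet E)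
    (hE1 : ∀ p ∈ E, p.1.1 ∈ Icc (0:ℝ) 1 ∧ p.1.2 ∈ Icc (0:ℝ) 1 ∧ p.2 ∈ Icc t0 (t0 + ℓ))
    (hE2 : ∀ p ∈ E, |α (p.1 + W2 p.2) * Real.sin p.2 + β (p.1 + W1 p.2) * Real.cos p.2| ≤ δ * ω^12) :
    volume E ≤ ENNReal.ofReal ((864 * (6 + 4 * 115200 / c₁ * 72) + 1) * δ * ω) := by
  set C : ℝ := 6 + 4 * 115200 / c₁ * 72 with hC
  have hCpos : 0 < C := by positivity
  set χ : (ℝ × ℝ) × ℝ → ENNReal := E.indicator 1 with hχd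
  have hχ : Measurable χ := measurable_one.indicator hE
  have hχ0 : ∀ p, p ∉ E → χ p = 0 := fun p hp => indicator_of_notMem hp _
  have hχ1 : ∀ p, χ p ≤ 1 := fun p => indicator_le_self' (fun _ _ => zero_le) p
  set B1 : Set (ℝ × ℝ) := Icc (0:ℝ) 1 ×ˢ Icc (-1:ℝ) 2
  set B2 : Set (ℝ × ℝ) := Icc (-1:ℝ) 2 ×ˢ Icc (0:ℝ) 1
  have vB1 : volume B1 = 3 := by
    rw [Measure.volume_eq_prod, Measure.prod_prod, Real.volume_Icc, Real.volume_Icc]; norm_num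
  have vB2 : volume B2 = 3 := by
    rw [Measure.volume_eq_prod, Measure.prod_prod, Real.volume_Icc, Real.volume_Icc]; norm_num
  have mB1 : MeasurableSet B1 := measurableSet_Icc.prod measurableSet_Icc
  have mB2 : MeasurableSet B2 := measurableSet_Icc.prod measurableSet_Icc
  have hz1 : ∀ z, z ∉ B1 → ∀ t, χ (z - W1 t, t) = 0 := by
    intro z hz t
    apply hχ0
    intro hp
    obtain ⟨h1, h2, -⟩ := hE1 _ hp
    simp only [W1, Prod.fst_sub, Prod.snd_sub, sub_zero, mem_Icc] at h1 h2
    exact hz ⟨h1, by linarith [Real.neg_one_le_sin t], by linarith [Real.sin_le_one t]⟩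
  have hz2 : ∀ z, z ∉ B2 → ∀ t, χ (z - W2 t, t) = 0 := by
    intro z hz t
    apply hχ0
    intro hp
    obtain ⟨h1, h2, -⟩ := hE1 _ hp
    simp only [W2, Prod.fst_sub, Prod.snd_sub, sub_zero, mem_Icc] at h1 h2
    exact hz ⟨⟨by linarith [Real.neg_one_le_cos t], by linarith [Real.cos_le_one t]⟩, h2⟩
  have low := refine_lower hχ W1_meas W2_meas B1 B2 mB1 (fun z hz => by simp [dg, hz1 z hz])
    mB2 (fun z hz => by simp [dg, hz2 z hz])
  have up : ∫⁻ p : (ℝ × ℝ) × ℝ, χ p * (dg χ W1 (p.1 + W1 p.2) * dg χ W2 (p.1 + W2 p.2)) ≤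
      ENNReal.ofReal (C * δ^3 * ω^3) * 3 := by
    rw [path_eq hχ W1_meas W2_meas, ← vB1, ← lintegral_indicator_const mB1]
    apply lintegral_mono
    intro z
    by_cases hz : z ∈ B1
    swap
    · simp [hz1 z hz]
    rw [indicator_of_mem hz]
    set a : ℝ × ℝ → ℝ := fun V => α (z + (V.1, -V.2)) with ha
    have ham : Measurable a := by apply hα.comp; fun_prop
    have hT := TT_vol (b := β z) ham hc₁ hh0 hh hδ hδ1 ht0 ht1 hl hlh (η := ω^3) (by positivity)
      (fun V => hac _)
    refine le_trans ?_ hT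
    have mT := TT_meas δ t0 ℓ (ω^3) (β z) a ham
    set T := TT δ t0 ℓ (ω^3) (β z) a
    have hTm : Measurable (T.indicator (1 : ℝ × ℝ × ℝ → ENNReal)) := measurable_one.indicator mT
    calc _ ≤ ∫⁻ t1, ∫⁻ t2, ∫⁻ t3, T.indicator (1 : ℝ × ℝ × ℝ → ENNReal) (t2, t1, t3) := by
          refine lintegral_mono fun t1 => lintegral_mono fun t2 => lintegral_mono fun t3 => ?_
          beta_reduce
          by_cases k1 : (z - W1 t1, t1) ∈ E
          swap
          · rw [hχ0 _ k1]; simp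
          by_cases k2 : (z - W1 t1 + W2 t1 - W2 t2, t2) ∈ E
          swap
          · rw [hχ0 _ k2]; simp
          by_cases k3 : (z - W1 t1 + W2 t1 - W2 t2 + W1 t2 - W1 t3, t3) ∈ E
          swap
          · rw [hχ0 _ k3]; simp
          have hmem : (t2, t1, t3) ∈ T := by
            obtain ⟨-, -, j1⟩ := hE1 _ k1
            obtain ⟨-, -, j2⟩ := hE1 _ k2
            obtain ⟨-, -, j3⟩ := hE1 _ k3
            have q1 := hE2 _ k1
            have q2 := hE2 _ k2
            have q3 := hE2 _ k3
            refine ⟨j2, j1, j3, ?_⟩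
            dsimp only at *
            have r1 : z - W1 t1 + W1 t1 = z := by abel
            have r2 : z - W1 t1 + W2 t1 - W2 t2 + W2 t2 = z - W1 t1 + W2 t1 := by abel
            have r3 : z - W1 t1 + W2 t1 - W2 t2 + W1 t2 - W1 t3 + W1 t3 = z - W1 t1 + W2 t1 - W2 t2 + W1 t2 := by abel
            have r4 : z - W1 t1 + W2 t1 - W2 t2 + W1 t2 - W1 t3 + W2 t3 =
                z + ((Psi t2 (t1, t3)).1, -(Psi t2 (t1, t3)).2) := by
              ext
              · simp [W1, W2, Psi]; ring
              · simp [W1, W2, Psi]; ring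
            rw [r1] at q1
            rw [r2] at q2
            rw [r3, r4] at q3
            simp only [ha]
            set A2 := α (z + ((Psi t2 (t1, t3)).1, -(Psi t2 (t1, t3)).2))
            set A1 := α (z - W1 t1 + W2 t1)
            set b1 := β (z - W1 t1 + W2 t1 - W2 t2 + W1 t2)
            have sb : ∀ t ∈ Icc t0 (t0+ℓ), |Real.sin t| ≤ 2 * δ := by
              rintro t ⟨x1, x2⟩
              refine Real.abs_sin_le_abs.trans ?_
              rw [abs_of_nonneg (by linarith)]; linarith
            have cb := Real.abs_cos_le_one
            have e : A2 * (Real.sin t1 * Real.cos t2 * Real.sin t3) + β z * (Real.cos t1 * Real.sin t2 * Real.cos t3)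
              = Real.sin t1 * Real.cos t2 * (A2 * Real.sin t3 + b1 * Real.cos t3)
               - Real.sin t1 * Real.cos t3 * (A1 * Real.sin t2 + b1 * Real.cos t2)
               + Real.sin t2 * Real.cos t3 * (A1 * Real.sin t1 + β z * Real.cos t1) := by ring
            have bd : ∀ s c q : ℝ, |s| ≤ 2 * δ → |c| ≤ 1 → |q| ≤ δ * ω^12 → |s * c * q| ≤ 2 * δ^2 * ω^12 := by
              intro s c q x1 x2 x3
              rw [abs_mul, abs_mul]
              calc _ ≤ 2 * δ * 1 * (δ * ω^12) := by gcongr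
                _ = _ := by ring
            have z1 := abs_le.1 (bd _ _ _ (sb _ j1) (cb t2) q3)
            have z2 := abs_le.1 (bd _ _ _ (sb _ j1) (cb t3) q2)
            have z3 := abs_le.1 (bd _ _ _ (sb _ j2) (cb t3) q1)
            rw [e, abs_le, ← pow_mul]
            norm_num only
            constructor <;> linarith
          rw [indicator_of_mem hmem]
          calc _ ≤ (1 : ENNReal) * (1 * 1) := by
                gcongr <;> apply hχ1
            _ = _ := by simp
      _ = ∫⁻ t2, ∫⁻ t1, ∫⁻ t3, T.indicator (1 : ℝ × ℝ × ℝ → ENNReal) (t2, t1, t3) := by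
          refine lintegral_lintegral_swap (f := fun t1 t2 => ∫⁻ t3, T.indicator (1 : ℝ × ℝ × ℝ → ENNReal) (t2, t1, t3)) ?_
          apply Measurable.aemeasurable
          have : Measurable fun q : (ℝ × ℝ) × ℝ => T.indicator (1 : ℝ × ℝ × ℝ → ENNReal) (q.1.2, q.1.1, q.2) := by
            apply hTm.comp; fun_prop
          exact this.lintegral_prod_right'
      _ = volume T := by
          rw [← lintegral_indicator_one mT, Measure.volume_eq_prod, lintegral_prod _ hTm.aemeasurable]
          apply lintegral_congr; intro t2
          rw [Measure.volume_eq_prod, lintegral_prod]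
          exact (hTm.comp (measurable_prodMk_left (x := t2))).aemeasurable
  have hint : ∫⁻ p, χ p = volume E := lintegral_indicator_one hE
  have hfin : volume E ≠ ⊤ := by
    have : E ⊆ (Icc (0:ℝ) 1 ×ˢ Icc (0:ℝ) 1) ×ˢ Icc t0 (t0+ℓ) := fun p hp => by
      obtain ⟨h1, h2, h3⟩ := hE1 _ hp
      exact ⟨⟨h1, h2⟩, h3⟩
    refine ne_top_of_le_ne_top ?_ (measure_mono this)
    exact ((isCompact_Icc.prod isCompact_Icc).prod isCompact_Icc).measure_lt_top.ne
  set m : ℝ := (volume E).toReal with hm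
  have hm0 : 0 ≤ m := ENNReal.toReal_nonneg
  have hmE : volume E = ENNReal.ofReal m := (ENNReal.ofReal_toReal hfin).symm
  have l := (low (ENNReal.ofReal (m/12))).trans (add_le_add_right up _)
  rw [hint, hmE, vB1, vB2] at l
  have h3 : (3 : ENNReal) = ENNReal.ofReal 3 := by simp
  rw [h3, ← ENNReal.ofReal_pow (by positivity), ← ENNReal.ofReal_mul (by positivity),
    ← ENNReal.ofReal_mul (by positivity), ← ENNReal.ofReal_mul (by positivity),
    ← ENNReal.ofReal_add (by positivity) (by positivity), ← ENNReal.ofReal_mul (by positivity),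
    ← ENNReal.ofReal_add (by positivity) (by positivity),
    ENNReal.ofReal_le_ofReal_iff (by positivity)] at l
  rw [hmE]
  apply ENNReal.ofReal_le_ofReal
  have l2 : m^3 ≤ 864 * C * (δ * ω)^3 := by
    have : (δ * ω)^3 = δ^3 * ω^3 := by ring
    rw [this]; nlinarith
  have l3 : m^3 ≤ ((864 * C + 1) * δ * ω)^3 := by
    refine l2.trans ?_
    have : ((864 * C + 1) * δ * ω)^3 = (864 * C + 1)^3 * (δ * ω)^3 := by ring
    rw [this]
    gcongr
    nlinarith [pow_pos hCpos 3, pow_pos hCpos 2]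
  exact le_of_pow_le_pow_left₀ (by norm_num) (by positivity) l3

end SLE

theorem sublevel_set_estimate (c₁ c₂ c₃ : ℝ)
    (hc₁ : 0 < c₁) (hc₂ : 0 < c₂) (hc₃ : 0 < c₃) :
    ∃ C : ℝ, 0 < C ∧ ∀ (δ : ℝ), 0 < δ → δ ≤ 1 →
      ∀ K : Set ((ℝ × ℝ) × ℝ), IsCompact K →
        K ⊆ (Icc (0:ℝ) 1 ×ˢ Icc (0:ℝ) 1) ×ˢ Icc δ (2 * δ) →
        ∀ α β : ℝ × ℝ → ℝ, Measurable α → Measurable β →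
          (∀ z, c₁ ≤ |α z| ∧ |α z| ≤ c₂) → (∀ z, |β z| ≤ c₃) →
          ∀ ε : ℝ, 0 < ε → ε ≤ 1 →
            volume {p ∈ K |
                |α (p.1.1 + Real.cos p.2, p.1.2) * Real.sin p.2
                  + β (p.1.1, p.1.2 + Real.sin p.2) * Real.cos p.2| ≤ δ * ε}
              ≤ ENNReal.ofReal (C * δ * ε ^ ((1:ℝ) / 35)) := by
  obtain ⟨h, hh0, hh⟩ := SLE.exists_h
  obtain ⟨n, hn⟩ := exists_nat_gt (4 / h)
  have hn0 : (0:ℝ) < n := lt_trans (by positivity) hn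
  have hn0' : 0 < n := by exact_mod_cast hn0
  set C0 : ℝ := 864 * (6 + 4 * 115200 / c₁ * 72) + 1 with hC0
  have hC0p : 0 < C0 := by positivity
  refine ⟨n * C0, by positivity, ?_⟩
  intro δ hδ hδ1 K hK hKs α β hα hβ hαb hβb ε hε hε1
  set ω : ℝ := ε ^ ((1:ℝ)/12) with hω
  have hωp : 0 < ω := Real.rpow_pos_of_pos hε _
  have hω12 : ω ^ 12 = ε := by
    rw [hω, ← Real.rpow_natCast, ← Real.rpow_mul hε.le]; norm_num
  have hωle : ω ≤ ε ^ ((1:ℝ)/35) := Real.rpow_le_rpow_of_exponent_ge hε hε1 (by norm_num)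
  set S : Set ((ℝ × ℝ) × ℝ) := {p ∈ K |
                |α (p.1.1 + Real.cos p.2, p.1.2) * Real.sin p.2
                  + β (p.1.1, p.1.2 + Real.sin p.2) * Real.cos p.2| ≤ δ * ε} with hS
  have mS : MeasurableSet S := by
    have f1 : Measurable fun p : (ℝ × ℝ) × ℝ => α (p.1.1 + Real.cos p.2, p.1.2) := by
      apply hα.comp; fun_prop
    have f2 : Measurable fun p : (ℝ × ℝ) × ℝ => β (p.1.1, p.1.2 + Real.sin p.2) := by
      apply hβ.comp; fun_prop
    have f3 : Measurable fun p : (ℝ × ℝ) × ℝ => |α (p.1.1 + Real.cos p.2, p.1.2) * Real.sin p.2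
                  + β (p.1.1, p.1.2 + Real.sin p.2) * Real.cos p.2| := by fun_prop
    exact hK.measurableSet.inter (measurableSet_le f3 measurable_const)
  let t0 : ℕ → ℝ := fun i => δ + i * (δ / n)
  let P : ℕ → Set ((ℝ × ℝ) × ℝ) := fun i => S ∩ {p | p.2 ∈ Icc (t0 i) (t0 i + δ / n)}
  have hcov : S ⊆ ⋃ i ∈ Finset.range n, P i := by
    intro p hp
    obtain ⟨-, ht1, ht2⟩ := hKs hp.1
    set x := (p.2 - δ) / (δ / n) with hx
    have hx0 : 0 ≤ x := div_nonneg (by linarith) (by positivity)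
    have hpx : p.2 = δ + x * (δ / n) := by rw [hx]; field_simp; ring
    have hxn : x ≤ n := by
      rw [hx, div_le_iff₀ (by positivity)]; field_simp; linarith
    obtain ⟨i, hi, hi1, hi2⟩ : ∃ i < n, (i:ℝ) ≤ x ∧ x ≤ i + 1 := by
      rcases hxn.lt_or_eq with h1 | h1
      · refine ⟨⌊x⌋₊, (Nat.floor_lt hx0).2 h1, Nat.floor_le hx0, (Nat.lt_floor_add_one x).le⟩
      · refine ⟨n - 1, by omega, ?_, ?_⟩ <;> rw [Nat.cast_sub hn0'] <;> push_cast <;> linarith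
    simp only [mem_iUnion, Finset.mem_range]
    refine ⟨i, hi, hp, ?_, ?_⟩
    · simp only [t0]; rw [hpx]; gcongr
    · simp only [t0]; rw [hpx]
      have : δ + i * (δ / n) + δ / n = δ + (i + 1) * (δ / n) := by ring
      rw [this]; gcongr
  have hP : ∀ i ∈ Finset.range n, volume (P i) ≤ ENNReal.ofReal (C0 * δ * ω) := by
    intro i hi
    rw [Finset.mem_range] at hi
    have hi' : (i:ℝ) + 1 ≤ n := by exact_mod_cast hi
    have hdn : 0 < δ / n := by positivity
    refine SLE.piece (β := β) (t0 := t0 i) (ℓ := δ / n) hα hc₁ hh0 hh hδ hδ1 ?_ ?_ hdn.le ?_ hωp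
      (fun z => (hαb z).1) (P i) ?_ ?_ ?_
    · simp only [t0]; have : 0 ≤ (i:ℝ) * (δ / n) := by positivity
      linarith
    · simp only [t0]
      have : ((i:ℝ) + 1) * (δ / n) ≤ n * (δ / n) := by gcongr
      have e : n * (δ / n) = δ := by field_simp
      linarith
    · rw [div_le_div_iff₀ hn0 (by norm_num)]
      rw [div_lt_iff₀ hh0] at hn
      nlinarith
    · exact mS.inter (measurable_snd measurableSet_Icc)
    · intro p hp
      obtain ⟨⟨h1, h2⟩, -⟩ := hKs hp.1.1
      exact ⟨h1, h2, hp.2⟩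
    · intro p hp
      have := hp.1.2
      have e1 : p.1 + SLE.W2 p.2 = (p.1.1 + Real.cos p.2, p.1.2) := by ext <;> simp [SLE.W2]
      have e2 : p.1 + SLE.W1 p.2 = (p.1.1, p.1.2 + Real.sin p.2) := by ext <;> simp [SLE.W1]
      rw [hω12, e1, e2]
      exact this
  calc volume S ≤ volume (⋃ i ∈ Finset.range n, P i) := measure_mono hcov
    _ ≤ ∑ i ∈ Finset.range n, volume (P i) := measure_biUnion_finset_le _ _
    _ ≤ ∑ i ∈ Finset.range n, ENNReal.ofReal (C0 * δ * ω) := Finset.sum_le_sum hP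
    _ = ENNReal.ofReal (n * C0 * δ * ω) := by
        rw [Finset.sum_const, Finset.card_range, nsmul_eq_mul, ← ENNReal.ofReal_natCast,
          ← ENNReal.ofReal_mul hn0.le]
        congr 1; ring
    _ ≤ _ := by
        apply ENNReal.ofReal_le_ofReal
        gcongr
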